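/- Let f : ℝ^n → ℝ and assume σ := 2·min{s_1, …, s_m} - 1 > 0. Let u : ℝ^n → ℝ be a classical solution of L u = f in the whole of ℝ^n. Assume that f does not depend on the n-th coordinate, i.e. f(x + ρ e_n) = f(x) for all x ∈ ℝ^n and ρ ∈ ℝ, and that ‖u‖_{L^∞(B_R)} = o(R^σ) as R → +∞, i.e. lim_{R→+∞} (sup_{B_R} |u|)/R^σ = 0. Then u does not depend on the n-th coordinate: u(x + ρ e_n) = u(x) for all x ∈ ℝ^n and all ρ ∈ ℝ. -/

import Mathlib

open MeasureTheory Real Filter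

noncomputable section

/-- The normalization constant `c_{N,s}`. -/
def cns (N : ℕ) (s : ℝ) : ℝ :=
  2 ^ (2 * s - 1) * Real.Gamma (s + (N : ℝ) / 2) /
    (Real.pi ^ ((N : ℝ) / 2) * |Real.Gamma (-s)|)

/-- The constant `η_i`. -/
def etaC (N : ℕ) (s : ℝ) : ℝ :=
  Real.Gamma ((N : ℝ) / 2) /
    (2 ^ (2 * s) * Real.Gamma (s + 1) * Real.Gamma (s + (N : ℝ) / 2))

/-- `ℝ^n` with coordinates grouped according to `N : ι → ℕ`. -/
abbrev GS {ι : Type*} (N : ι → ℕ) : Type _ :=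
  PiLp 2 (fun i : ι => EuclideanSpace ℝ (Fin (N i)))

/-- The inclusion `y ↦ y^{(i)}`. -/
def grpIncl {ι : Type*} [DecidableEq ι] (N : ι → ℕ) (i : ι)
    (y : EuclideanSpace ℝ (Fin (N i))) : GS N :=
  WithLp.toLp 2 (Pi.single i y)

/-- Second derivative of `u` at `x` in direction `v`. -/
def dirD2 {E : Type*} [NormedAddCommGroup E] [NormedSpace ℝ E]
    (u : E → ℝ) (x v : E) : ℝ :=
  iteratedDeriv 2 (fun t : ℝ => u (x + t • v)) 0

/-- The operator `(-Δ_{X_i})^{s_i}`. -/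
def gLap {ι : Type*} [Fintype ι] [DecidableEq ι] (N : ι → ℕ) (i : ι) (si : ℝ)
    (u : GS N → ℝ) (x : GS N) : ℝ :=
  if si = 1 then
    -∑ j : Fin (N i), dirD2 u x (grpIncl N i (EuclideanSpace.single j 1))
  else
    cns (N i) si *
      ∫ y : EuclideanSpace ℝ (Fin (N i)),
        (2 * u x - u (x + grpIncl N i y) - u (x - grpIncl N i y)) /
          ‖y‖ ^ ((N i : ℝ) + 2 * si)

/-- Absolute convergence of the integral defining `(-Δ_{X_i})^{s_i} u (x)`
(trivial in the local case `s_i = 1`). -/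
def gInt {ι : Type*} [Fintype ι] [DecidableEq ι] (N : ι → ℕ) (i : ι) (si : ℝ)
    (u : GS N → ℝ) (x : GS N) : Prop :=
  si = 1 ∨ Integrable (fun y : EuclideanSpace ℝ (Fin (N i)) =>
    (2 * u x - u (x + grpIncl N i y) - u (x - grpIncl N i y)) /
      ‖y‖ ^ ((N i : ℝ) + 2 * si))

/-- The operator `L = Σ_i a_i (-Δ_{X_i})^{s_i}`. -/
def Lop {ι : Type*} [Fintype ι] [DecidableEq ι] (N : ι → ℕ) (a s : ι → ℝ)
    (u : GS N → ℝ) (x : GS N) : ℝ :=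
  ∑ i, a i * gLap N i (s i) u x

/-- `u` is a classical solution of `L u = f` in `Ω`. -/
def IsSol {ι : Type*} [Fintype ι] [DecidableEq ι] (N : ι → ℕ) (a s : ι → ℝ)
    (u f : GS N → ℝ) (Ω : Set (GS N)) : Prop :=
  Continuous u ∧ ∀ x ∈ Ω, ContDiffAt ℝ 2 u x ∧ (∀ i, gInt N i (s i) u x) ∧
    Lop N a s u x = f x

/-- The unit vector `e_n` (the last group has one coordinate). -/
def eN {m : ℕ} (N : Fin (m + 1) → ℕ) : GS N :=
  grpIncl N (Fin.last m) (WithLp.toLp 2 (fun _ => (1 : ℝ)))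

/-- The box `Q_{d,κ}`. -/
def Qset {m : ℕ} (N : Fin (m + 1) → ℕ) (d : Fin (m + 1) → ℝ) (κ : ℝ) :
    Set (GS N) :=
  {x | (∀ i, i ≠ Fin.last m → ‖x i‖ < d i) ∧
    ‖x (Fin.last m)‖ < κ * d (Fin.last m)}

/-- The cube `(-c,c)^n`. -/
def gCube {m : ℕ} (N : Fin (m + 1) → ℕ) (c : ℝ) : Set (GS N) :=
  {x | ∀ (i : Fin (m + 1)) (j : Fin (N i)), |x i j| < c}

/-- `ℋ^{N-1}(S^{N-1})`. -/
def sphVol (n : ℕ) : ℝ :=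
  (μH[(n : ℝ) - 1] (Metric.sphere (0 : EuclideanSpace ℝ (Fin n)) 1)).toReal

/-- The operator `L_*` acting on functions of `(x,t) ∈ ℝ^n × ℝ`. -/
def LstarOp {m : ℕ} (N : Fin (m + 1) → ℕ) (a s : Fin (m + 1) → ℝ) (ν : ℝ)
    (h : GS N × ℝ → ℝ) (p : GS N × ℝ) : ℝ :=
  (∑ i ∈ Finset.univ.erase (Fin.last m),
      a i * gLap N i (s i) (fun z => h (z, p.2)) p.1)
    - (a (Fin.last m) - ν) * dirD2 (fun z => h (z, p.2)) p.1 (eN N)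
    - ν * dirD2 (fun τ : ℝ => h (p.1, τ)) p.2 1

/-- The barrier `Φ`. -/
def PhiBar {m : ℕ} (N : Fin (m + 1) → ℕ) (s d : Fin (m + 1) → ℝ)
    (ν A₁ A₂ : ℝ) (p : GS N × ℝ) : ℝ :=
  A₁ / ν * (max p.2 0 * max (d (Fin.last m) - p.2) 0 / 2)
    + A₂ * ((∑ i, etaC (N i) (s i) * d i ^ (2 * s i))
        + d (Fin.last m) ^ 2 / 2
        - ∑ i, etaC (N i) (s i) * max (d i ^ 2 - ‖p.1 i‖ ^ 2) 0 ^ s i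
        - max (d (Fin.last m) ^ 2 - p.2 ^ 2) 0 / 2)

/-- `sup` of `|u|` on the open annulus `B_{2ρ} ∖ closure(B_{ρ/2})`. -/
def annSup {n : ℕ} (u : EuclideanSpace ℝ (Fin n) → ℝ) (ρ : ℝ) : ℝ :=
  sSup ((fun x => |u x|) '' {x | ρ / 2 < ‖x‖ ∧ ‖x‖ < 2 * ρ})

/-- `sup` of `|u|` on the open ball `B_r`. -/
def ballSup {n : ℕ} (u : EuclideanSpace ℝ (Fin n) → ℝ) (r : ℝ) : ℝ :=
  sSup ((fun x => |u x|) '' Metric.ball 0 r)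


lemma aux_secdiff (φ : ℝ → ℝ) (c : ℝ) (hφ : ContDiffAt ℝ 2 φ 0)
    (h : ∀ᶠ t in nhds (0 : ℝ), φ t + φ (-t) - 2 * φ 0 ≤ c * t ^ 2) :
    iteratedDeriv 2 φ 0 ≤ c := by
  by_contra hc
  push Not at hc
  have hneg : ContDiffAt ℝ 2 (fun t => φ (-t)) 0 := by
    have : ContDiffAt ℝ 2 φ (-0) := by simpa using hφ
    exact this.comp (0 : ℝ) contDiffAt_id.neg
  have hsq : ContDiffAt ℝ 2 (fun t : ℝ => c * t ^ 2) 0 := by fun_prop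
  set ψ : ℝ → ℝ := (φ + fun t => φ (-t)) - fun t => c * t ^ 2 with hψ
  have hadd : ContDiffAt ℝ 2 (φ + fun t => φ (-t)) 0 := hφ.add hneg
  have hψC : ContDiffAt ℝ 2 ψ 0 := hadd.sub hsq
  have hd2 : iteratedDeriv 2 ψ 0 = 2 * iteratedDeriv 2 φ 0 - 2 * c := by
    rw [hψ, iteratedDeriv_sub (n := 2) hadd hsq, iteratedDeriv_add (n := 2) hφ hneg,
      iteratedDeriv_comp_neg]
    have : iteratedDeriv 2 (fun t : ℝ => c * t ^ 2) 0 = 2 * c := by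
      simp [iteratedDeriv_succ, mul_comm]
    rw [this]; simp; ring
  have heven : ∀ t, ψ (-t) = ψ t := by intro t; simp [hψ]; ring
  have hd1 : deriv ψ 0 = 0 := by
    have h1 : deriv (fun t => ψ (-t)) 0 = - deriv ψ (-0) := deriv_comp_neg ψ 0
    simp only [heven, neg_zero] at h1
    linarith
  have hdd : deriv (deriv ψ) 0 = iteratedDeriv 2 ψ 0 := by
    simp [iteratedDeriv_succ]
  have hmin := isLocalMin_of_deriv_deriv_pos (f := ψ) (x₀ := 0)
    (by rw [hdd, hd2]; linarith) hd1 hψC.continuousAt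
  have heq : ψ =ᶠ[nhds 0] fun _ => ψ 0 := by
    filter_upwards [hmin, h] with t h1 h2
    refine le_antisymm ?_ h1
    simp [hψ]; linarith
  have : deriv (deriv ψ) 0 = 0 := by
    have := heq.deriv.deriv_eq
    rw [this]; simp
  rw [hdd, hd2] at this
  linarith

lemma aux_bern {p b z : ℝ} (hp : 0 ≤ p) (hp1 : p ≤ 1) (hb : 0 < b) (hz : 0 ≤ z) :
    (b + z) ^ p ≤ b ^ p + z * b ^ (p - 1) := by
  have h1 := rpow_one_add_le_one_add_mul_self (s := z / b)
    (by have : 0 ≤ z / b := by positivity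
        linarith) hp hp1
  have h2 : (b + z) ^ p = b ^ p * (1 + z / b) ^ p := by
    rw [← Real.mul_rpow hb.le (by positivity)]
    congr 1; field_simp
  rw [h2, Real.rpow_sub hb, Real.rpow_one]
  have hbp : 0 < b ^ p := Real.rpow_pos_of_pos hb p
  have h3 : b ^ p * (1 + z / b) ^ p ≤ b ^ p * (1 + p * (z / b)) := by gcongr
  have h4 : p * (z / b) ≤ z / b := mul_le_of_le_one_left (by positivity) hp1
  have h5 : b ^ p * (1 + p * (z / b)) ≤ b ^ p * (1 + z / b) := by gcongr
  have h6 : b ^ p * (1 + z / b) = b ^ p + z * (b ^ p / b) := by field_simp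
  linarith

lemma aux_g {E : Type*} [NormedAddCommGroup E] [InnerProductSpace ℝ E] {σ R : ℝ}
    (hσ : 0 < σ) (hσ1 : σ ≤ 1) (hR : 1 ≤ R) (x y : E) :
    (R ^ 2 + ‖x + y‖ ^ 2) ^ (σ / 2) + (R ^ 2 + ‖x - y‖ ^ 2) ^ (σ / 2)
      - 2 * (R ^ 2 + ‖x‖ ^ 2) ^ (σ / 2) ≤ 2 * min (‖y‖ ^ 2 * R ^ (σ - 2)) (‖y‖ ^ σ) := by
  have hR0 : 0 < R := by linarith
  have hcv := @(Real.concaveOn_rpow (p := σ / 2) (by linarith) (by linarith)).2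
    (R ^ 2 + ‖x + y‖ ^ 2) (by simp only [Set.mem_Ici]; positivity)
    (R ^ 2 + ‖x - y‖ ^ 2) (by simp only [Set.mem_Ici]; positivity)
    (1 / 2) (1 / 2) (by norm_num) (by norm_num) (by norm_num)
  simp only [smul_eq_mul] at hcv
  have hp := parallelogram_law_with_norm ℝ x y
  have he : 1 / 2 * (R ^ 2 + ‖x + y‖ ^ 2) + 1 / 2 * (R ^ 2 + ‖x - y‖ ^ 2)
      = (R ^ 2 + ‖x‖ ^ 2) + ‖y‖ ^ 2 := by linarith
  rw [he] at hcv
  have h1 : ((R ^ 2 + ‖x‖ ^ 2) + ‖y‖ ^ 2) ^ (σ / 2) ≤ (R ^ 2 + ‖x‖ ^ 2) ^ (σ / 2) + ‖y‖ ^ σ := by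
    have := Real.rpow_add_le_add_rpow (p := σ / 2) (a := R ^ 2 + ‖x‖ ^ 2) (b := ‖y‖ ^ 2)
      (by positivity) (by positivity) (by linarith) (by linarith)
    have h2 : (‖y‖ ^ 2) ^ (σ / 2) = ‖y‖ ^ σ := by
      rw [← Real.rpow_natCast, ← Real.rpow_mul (norm_nonneg _)]; congr 1; push_cast; ring
    rwa [h2] at this
  have h2 : ((R ^ 2 + ‖x‖ ^ 2) + ‖y‖ ^ 2) ^ (σ / 2)
      ≤ (R ^ 2 + ‖x‖ ^ 2) ^ (σ / 2) + ‖y‖ ^ 2 * R ^ (σ - 2) := by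
    have h3 := aux_bern (p := σ / 2) (b := R ^ 2 + ‖x‖ ^ 2) (z := ‖y‖ ^ 2)
      (by linarith) (by linarith) (by positivity) (by positivity)
    have h4 : (R ^ 2 + ‖x‖ ^ 2) ^ (σ / 2 - 1) ≤ R ^ (σ - 2) := by
      have h5 : (R ^ 2 + ‖x‖ ^ 2) ^ (σ / 2 - 1) ≤ (R ^ 2) ^ (σ / 2 - 1) :=
        Real.rpow_le_rpow_of_nonpos (by positivity) (by nlinarith [norm_nonneg x]) (by linarith)
      have h6 : (R ^ 2) ^ (σ / 2 - 1) = R ^ (σ - 2) := by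
        rw [← Real.rpow_natCast, ← Real.rpow_mul hR0.le]; congr 1; push_cast; ring
      rwa [h6] at h5
    have : ‖y‖ ^ 2 * (R ^ 2 + ‖x‖ ^ 2) ^ (σ / 2 - 1) ≤ ‖y‖ ^ 2 * R ^ (σ - 2) := by gcongr
    linarith
  have : ((R ^ 2 + ‖x‖ ^ 2) + ‖y‖ ^ 2) ^ (σ / 2) - (R ^ 2 + ‖x‖ ^ 2) ^ (σ / 2)
      ≤ min (‖y‖ ^ 2 * R ^ (σ - 2)) (‖y‖ ^ σ) := le_min (by linarith) (by linarith)
  linarith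

lemma aux_int1 (n : ℕ) {σ s : ℝ} (hσs : σ < 2 * s) (hs1 : s < 1) :
    Integrable (fun y : EuclideanSpace ℝ (Fin n) =>
      min (‖y‖ ^ 2) (‖y‖ ^ σ) / ‖y‖ ^ ((n : ℝ) + 2 * s)) := by
  rcases Nat.eq_zero_or_pos n with rfl | hn
  · have : ∀ y : EuclideanSpace ℝ (Fin 0), y = 0 := fun y => Subsingleton.elim _ _
    have hf : (fun y : EuclideanSpace ℝ (Fin 0) =>
      min (‖y‖ ^ 2) (‖y‖ ^ σ) / ‖y‖ ^ (((0 : ℕ) : ℝ) + 2 * s)) = fun _ =>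
      min (‖(0 : EuclideanSpace ℝ (Fin 0))‖ ^ 2) (‖(0 : EuclideanSpace ℝ (Fin 0))‖ ^ σ)
        / ‖(0 : EuclideanSpace ℝ (Fin 0))‖ ^ (((0 : ℕ) : ℝ) + 2 * s) := by
      funext y; rw [this y]
    rw [hf]
    have : IsFiniteMeasure (volume : Measure (EuclideanSpace ℝ (Fin 0))) := by
      refine ⟨?_⟩
      have : (Set.univ : Set (EuclideanSpace ℝ (Fin 0))) = {0} := by
        ext y; simp [this y]
      exact (Set.finite_univ.isCompact).measure_lt_top
    exact integrable_const _
  · have : Nonempty (Fin n) := ⟨⟨0, hn⟩⟩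
    have : Nontrivial (EuclideanSpace ℝ (Fin n)) := by
      apply Module.nontrivial_of_finrank_pos (R := ℝ); simpa using hn
    have key := (integrable_fun_norm_addHaar (E := EuclideanSpace ℝ (Fin n)) volume
      (f := fun r : ℝ => min (r ^ 2) (r ^ σ) / r ^ ((n : ℝ) + 2 * s))).2
    apply key
    simp only [finrank_euclideanSpace, Fintype.card_fin, smul_eq_mul]
    have hm : ∀ r : ℝ, 0 < r → r ^ (n - 1) * (min (r ^ 2) (r ^ σ) / r ^ ((n : ℝ) + 2 * s))
        = min (r ^ (1 - 2 * s)) (r ^ (σ - 1 - 2 * s)) := by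
      intro r hr
      have e1 : r ^ (n - 1) = r ^ ((n : ℝ) - 1) := by
        rw [← Real.rpow_natCast]; congr 1; push_cast [hn]; ring
      have e2 : r ^ (n - 1) / r ^ ((n : ℝ) + 2 * s) = r ^ (-1 - 2 * s) := by
        rw [e1, ← Real.rpow_sub hr]; congr 1; ring
      have e3 : r ^ (n - 1) * (min (r ^ 2) (r ^ σ) / r ^ ((n : ℝ) + 2 * s))
        = r ^ (-1 - 2 * s) * min (r ^ 2) (r ^ σ) := by rw [← e2]; ring
      rw [e3, mul_min_of_nonneg _ _ (Real.rpow_nonneg hr.le _), ← Real.rpow_natCast,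
        ← Real.rpow_add hr, ← Real.rpow_add hr]
      congr 2
      · push_cast; ring
      · ring
    have hmeas : Measurable (fun r : ℝ => r ^ (n - 1) *
        (min (r ^ 2) (r ^ σ) / r ^ ((n : ℝ) + 2 * s))) := by fun_prop
    have hu : Set.Ioi (0 : ℝ) = Set.Ioc 0 1 ∪ Set.Ioi 1 := by
      rw [Set.Ioc_union_Ioi_eq_Ioi zero_le_one]
    rw [hu, integrableOn_union]
    constructor
    · have h1 : IntegrableOn (fun r : ℝ => r ^ (1 - 2 * s)) (Set.Ioc 0 1) := by
        have := intervalIntegral.intervalIntegrable_rpow' (a := 0) (b := 1) (r := 1 - 2 * s)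
          (by linarith)
        exact (intervalIntegrable_iff_integrableOn_Ioc_of_le zero_le_one).1 this
      refine Integrable.mono' h1 hmeas.aestronglyMeasurable ?_
      refine (ae_restrict_iff' measurableSet_Ioc).2 (Eventually.of_forall fun r hr => ?_)
      rw [hm r hr.1, Real.norm_of_nonneg (le_min (Real.rpow_nonneg hr.1.le _)
        (Real.rpow_nonneg hr.1.le _))]
      exact min_le_left _ _
    · have h1 : IntegrableOn (fun r : ℝ => r ^ (σ - 1 - 2 * s)) (Set.Ioi 1) :=
        integrableOn_Ioi_rpow_of_lt (by linarith) zero_lt_one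
      refine Integrable.mono' h1 hmeas.aestronglyMeasurable ?_
      refine (ae_restrict_iff' measurableSet_Ioi).2 (Eventually.of_forall fun r hr => ?_)
      have hr0 : (0 : ℝ) < r := lt_trans zero_lt_one hr
      rw [hm r hr0, Real.norm_of_nonneg (le_min (Real.rpow_nonneg hr0.le _)
        (Real.rpow_nonneg hr0.le _))]
      exact min_le_right _ _

lemma aux_intR (n : ℕ) {σ s : ℝ} (hσs : σ < 2 * s) (hs1 : s < 1) :
    ∃ C : ℝ, 0 ≤ C ∧ ∀ R : ℝ, 0 < R →
    Integrable (fun y : EuclideanSpace ℝ (Fin n) =>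
      min (‖y‖ ^ 2 * R ^ (σ - 2)) (‖y‖ ^ σ) / ‖y‖ ^ ((n : ℝ) + 2 * s)) ∧
    ∫ y : EuclideanSpace ℝ (Fin n),
      min (‖y‖ ^ 2 * R ^ (σ - 2)) (‖y‖ ^ σ) / ‖y‖ ^ ((n : ℝ) + 2 * s) = C * R ^ (σ - 2 * s) := by
  set F : EuclideanSpace ℝ (Fin n) → ℝ := fun y =>
      min (‖y‖ ^ 2) (‖y‖ ^ σ) / ‖y‖ ^ ((n : ℝ) + 2 * s) with hF
  have hFi : Integrable F := aux_int1 n hσs hs1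
  refine ⟨∫ y, F y, integral_nonneg fun y => ?_, fun R hR => ?_⟩
  · simp only [hF, Pi.zero_apply]
    have : 0 ≤ min (‖y‖ ^ 2) (‖y‖ ^ σ) := le_min (by positivity) (by positivity)
    positivity
  · have hsc : (fun y : EuclideanSpace ℝ (Fin n) =>
      min (‖y‖ ^ 2 * R ^ (σ - 2)) (‖y‖ ^ σ) / ‖y‖ ^ ((n : ℝ) + 2 * s))
        = fun y => R ^ (σ - 2 * s - n) * F (R⁻¹ • y) := by
      funext y
      simp only [hF, norm_smul, norm_inv, Real.norm_of_nonneg hR.le]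
      have h0 : 0 ≤ ‖y‖ := norm_nonneg y
      have hRi : 0 ≤ R⁻¹ := by positivity
      rw [Real.mul_rpow hRi h0, Real.mul_rpow hRi h0, mul_pow]
      have e1 : min (‖y‖ ^ 2 * R ^ (σ - 2)) (‖y‖ ^ σ)
          = R ^ σ * min (R⁻¹ ^ 2 * ‖y‖ ^ 2) (R⁻¹ ^ σ * ‖y‖ ^ σ) := by
        rw [mul_min_of_nonneg _ _ (by positivity)]
        congr 1
        · rw [Real.rpow_sub hR, Real.rpow_two]; field_simp
        · rw [Real.inv_rpow hR.le]; field_simp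
      rw [e1, Real.inv_rpow hR.le ((n : ℝ) + 2 * s)]
      have e2 : R ^ (σ - 2 * s - n) = R ^ σ / R ^ ((n : ℝ) + 2 * s) := by
        rw [← Real.rpow_sub hR]; congr 1; ring
      rw [e2]
      have : R ^ ((n : ℝ) + 2 * s) ≠ 0 := (Real.rpow_pos_of_pos hR _).ne'
      rw [div_mul_div_comm, mul_inv_cancel_left₀ this]
    rw [hsc]
    constructor
    · exact ((integrable_comp_smul_iff volume F (inv_ne_zero hR.ne')).2 hFi).const_mul _
    · rw [integral_const_mul, Measure.integral_comp_inv_smul_of_nonneg volume F hR.le]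
      simp only [finrank_euclideanSpace, Fintype.card_fin, smul_eq_mul]
      rw [← mul_assoc, ← Real.rpow_natCast, ← Real.rpow_add hR, mul_comm]
      congr 2; ring

lemma aux_incl_norm {ι : Type*} [Fintype ι] [DecidableEq ι] (N : ι → ℕ) (i : ι)
    (y : EuclideanSpace ℝ (Fin (N i))) : ‖grpIncl N i y‖ = ‖y‖ :=
  PiLp.norm_single 2 (fun i : ι => EuclideanSpace ℝ (Fin (N i))) i y

lemma aux_incl_smul {ι : Type*} [Fintype ι] [DecidableEq ι] (N : ι → ℕ) (i : ι) (t : ℝ)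
    (y : EuclideanSpace ℝ (Fin (N i))) : grpIncl N i (t • y) = t • grpIncl N i y := by
  unfold grpIncl
  rw [Pi.single_smul, WithLp.toLp_smul]

lemma aux_cns (n : ℕ) {s : ℝ} (hs : 0 < s) : 0 ≤ cns n s := by
  unfold cns
  have : 0 < Real.Gamma (s + (n : ℝ) / 2) := Real.Gamma_pos_of_pos (by positivity)
  positivity

lemma aux_line {E : Type*} [NormedAddCommGroup E] [NormedSpace ℝ E] {u : E → ℝ} {p : E}
    (v : E) (hu : ContDiffAt ℝ 2 u p) : ContDiffAt ℝ 2 (fun t : ℝ => u (p + t • v)) 0 := by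
  have h : ContDiffAt ℝ 2 u (p + (0 : ℝ) • v) := by simpa using hu
  have h2 : ContDiffAt ℝ 2 (fun t : ℝ => p + t • v) 0 := by fun_prop
  exact h.comp (0 : ℝ) h2

lemma aux_lap {ι : Type*} [Fintype ι] [DecidableEq ι] (N : ι → ℕ) (i : ι) {si σ : ℝ}
    (hs0 : 0 < si) (hs1 : si ≤ 1) (hσs : σ ≤ 2 * si - 1) :
    ∃ C : ℝ, 0 ≤ C ∧ ∀ (R A : ℝ) (u : GS N → ℝ) (p q : GS N), 1 ≤ R → 0 ≤ A →
      ContDiffAt ℝ 2 u p → ContDiffAt ℝ 2 u q → gInt N i si u p → gInt N i si u q →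
      (∀ y : EuclideanSpace ℝ (Fin (N i)),
        -(2 * A * min (‖y‖ ^ 2 * R ^ (σ - 2)) (‖y‖ ^ σ)) ≤
        (2 * u p - u (p + grpIncl N i y) - u (p - grpIncl N i y))
        - (2 * u q - u (q + grpIncl N i y) - u (q - grpIncl N i y))) →
      -(2 * A * C * R⁻¹) ≤ gLap N i si u p - gLap N i si u q := by
  by_cases h1 : si = 1
  · refine ⟨N i, by positivity, fun R A u p q hR hA hup huq _ _ hy => ?_⟩
    have hRR : R ^ (σ - 2) ≤ R⁻¹ := by
      rw [← Real.rpow_neg_one]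
      exact Real.rpow_le_rpow_of_exponent_le hR (by linarith)
    simp only [gLap, if_pos h1]
    have key : ∀ j : Fin (N i), dirD2 u p (grpIncl N i (EuclideanSpace.single j 1))
        - dirD2 u q (grpIncl N i (EuclideanSpace.single j 1)) ≤ 2 * A * R⁻¹ := by
      intro j
      set e := grpIncl N i (EuclideanSpace.single j 1) with he
      unfold dirD2
      have hp := aux_line e hup
      have hq := aux_line e huq
      rw [← iteratedDeriv_sub (n := 2) hp hq]
      refine aux_secdiff _ _ (hp.sub hq) (Eventually.of_forall fun t => ?_)
      have h2 := hy (t • EuclideanSpace.single j 1)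
      rw [aux_incl_smul, ← he] at h2
      have h3 : ‖t • (EuclideanSpace.single j 1 : EuclideanSpace ℝ (Fin (N i)))‖ ^ 2 = t ^ 2 := by
        simp [norm_smul]
      have h4 := min_le_left
        (‖t • (EuclideanSpace.single j 1 : EuclideanSpace ℝ (Fin (N i)))‖ ^ 2 * R ^ (σ - 2))
        (‖t • (EuclideanSpace.single j 1 : EuclideanSpace ℝ (Fin (N i)))‖ ^ σ)
      rw [h3] at h2 h4
      have h5 : t ^ 2 * R ^ (σ - 2) ≤ t ^ 2 * R⁻¹ := by gcongr
      have h6 := mul_le_mul_of_nonneg_left (h4.trans h5) (by positivity : 0 ≤ 2 * A)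
      simp only [Pi.sub_apply, neg_smul, zero_smul, add_zero, ← sub_eq_add_neg]
      linarith
    have hsum := Finset.sum_le_sum (s := Finset.univ) fun j _ => key j
    rw [Finset.sum_sub_distrib] at hsum
    simp only [Finset.sum_const, Finset.card_univ, Fintype.card_fin, nsmul_eq_mul] at hsum
    linarith
  · have hlt : si < 1 := lt_of_le_of_ne hs1 h1
    obtain ⟨C, hC, hCR⟩ := aux_intR (N i) (σ := σ) (s := si) (by linarith) hlt
    have hc := aux_cns (N i) hs0
    refine ⟨cns (N i) si * C, by positivity, fun R A u p q hR hA _ _ hip hiq hy => ?_⟩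
    have hR0 : 0 < R := by linarith
    have hip := hip.resolve_left h1
    have hiq := hiq.resolve_left h1
    obtain ⟨hI, hIe⟩ := hCR R hR0
    simp only [gLap, if_neg h1]
    rw [← mul_sub, ← integral_sub hip hiq]
    have hle : -(2 * A * (C * R ^ (σ - 2 * si))) ≤
        ∫ y : EuclideanSpace ℝ (Fin (N i)),
        ((2 * u p - u (p + grpIncl N i y) - u (p - grpIncl N i y)) /
          ‖y‖ ^ ((N i : ℝ) + 2 * si) -
        (2 * u q - u (q + grpIncl N i y) - u (q - grpIncl N i y)) /
          ‖y‖ ^ ((N i : ℝ) + 2 * si)) := by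
      rw [← hIe, ← integral_const_mul, ← integral_neg]
      refine integral_mono (hI.const_mul _).neg (hip.sub hiq) fun y => ?_
      simp only []
      rw [← sub_div, ← mul_div_assoc, ← neg_div]
      have := hy y
      gcongr
    have hRR : R ^ (σ - 2 * si) ≤ R⁻¹ := by
      rw [← Real.rpow_neg_one]
      exact Real.rpow_le_rpow_of_exponent_le hR (by linarith)
    have h7 : 2 * A * (C * R ^ (σ - 2 * si)) ≤ 2 * A * (C * R⁻¹) := by gcongr
    have h8 := mul_le_mul_of_nonneg_left ((neg_le_neg h7).trans hle) hc
    calc _ = cns (N i) si * -(2 * A * (C * R⁻¹)) := by ring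
      _ ≤ _ := h8

lemma aux_dir_neg {E : Type*} [NormedAddCommGroup E] [NormedSpace ℝ E] (u : E → ℝ) (x v : E) :
    dirD2 u x (-v) = dirD2 u x v := by
  unfold dirD2
  have := iteratedDeriv_comp_neg 2 (fun t : ℝ => u (x + t • v)) 0
  simp only [neg_smul, neg_zero] at this
  simp only [smul_neg]
  rw [this]; simp

set_option maxHeartbeats 2000000 in
lemma aux_barrier {m : ℕ} (N : Fin (m + 1) → ℕ)
    (s : Fin (m + 1) → ℝ) (hs : ∀ i, s i ∈ Set.Ioc (0 : ℝ) 1)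
    (a : Fin (m + 1) → ℝ) (ha : ∀ i, 0 ≤ a i) (hal : 0 < a (Fin.last m))
    {σ : ℝ} (hσ : 0 < σ) (hσs : ∀ i, σ ≤ 2 * s i - 1)
    (u f : GS N → ℝ) (hsol : IsSol N a s u f Set.univ) (e : GS N) (he : ‖e‖ ≤ 1)
    (hf : ∀ (x : GS N) (ρ : ℝ), f (x + ρ • e) = f x)
    (hlast : ∀ x, gLap N (Fin.last m) (s (Fin.last m)) u x = - dirD2 u x e) :
    ∃ C : ℝ, 1 ≤ C ∧ ∀ δ R : ℝ, 0 < δ → 1 ≤ R → (∀ x, |u x| ≤ δ * (‖x‖ + R) ^ σ) →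
      ∀ (x : GS N) (t : ℝ), t ∈ Set.Icc 0 R → u (x + t • e) - u (x - t • e) ≤
        20 * δ * ((R ^ 2 + ‖x‖ ^ 2) ^ (σ / 2) - R ^ σ) + 20 * δ * C / R * (t * (2 * R - t)) := by
  have hσ1 : σ ≤ 1 := by have := hσs (Fin.last m); have := (hs (Fin.last m)).2; linarith
  choose C hC0 hC using fun i => aux_lap N i (hs i).1 (hs i).2 (hσs i)
  set l := Fin.last m with hl
  set S : ℝ := ∑ i ∈ Finset.univ.erase l, a i * C i with hS
  have hS0 : 0 ≤ S := Finset.sum_nonneg fun i _ => mul_nonneg (ha i) (hC0 i)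
  refine ⟨(a l + S) / a l, by rw [one_le_div hal]; linarith, fun δ R hδ hR hu => ?_⟩
  set C0 : ℝ := (a l + S) / a l with hC0d
  have hC01 : 1 ≤ C0 := by rw [hC0d, one_le_div hal]; linarith
  have hR0 : 0 < R := by linarith
  set A : ℝ := 20 * δ with hA
  have hA0 : 0 < A := by positivity
  set K : ℝ := A * C0 / R with hK
  have hK0 : 0 < K := by positivity
  obtain ⟨hcont, hs'⟩ := hsol
  have hRσ : (R ^ 2) ^ (σ / 2) = R ^ σ := by
    rw [← Real.rpow_natCast, ← Real.rpow_mul hR0.le]; congr 1; push_cast; ring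
  set g : GS N → ℝ := fun x => (R ^ 2 + ‖x‖ ^ 2) ^ (σ / 2) with hg
  have hgR : ∀ x, R ^ σ ≤ g x := by
    intro x
    rw [← hRσ]
    exact Real.rpow_le_rpow (by positivity) (by nlinarith [norm_nonneg x]) (by linarith)
  set W : GS N × ℝ → ℝ := fun z => u (z.1 + z.2 • e) - u (z.1 - z.2 • e)
    - (A * (g z.1 - R ^ σ) + K * (z.2 * (2 * R - z.2))) with hW
  have hgc : Continuous g := by
    apply Continuous.rpow_const (by fun_prop)
    intro x; left; positivity
  have hWc : Continuous W := by
    simp only [hW]; fun_prop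
  -- bound on v
  have hv : ∀ x t, t ∈ Set.Icc 0 R → u (x + t • e) - u (x - t • e) ≤ A / 2 * g x := by
    intro x t ht
    have hte : ‖t • e‖ ≤ R := by
      rw [norm_smul, Real.norm_of_nonneg ht.1]
      nlinarith [ht.1, ht.2, norm_nonneg e]
    have h5 : (‖x‖ + 2 * R) ^ σ ≤ 5 * g x := by
      have e1 : (‖x‖ + 2 * R) ^ σ = ((‖x‖ + 2 * R) ^ 2) ^ (σ / 2) := by
        rw [← Real.rpow_natCast, ← Real.rpow_mul (by positivity)]; congr 1; push_cast; ring
      have e2 : ((‖x‖ + 2 * R) ^ 2) ^ (σ / 2) ≤ (5 * (R ^ 2 + ‖x‖ ^ 2)) ^ (σ / 2) :=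
        Real.rpow_le_rpow (by positivity) (by nlinarith [sq_nonneg (2 * ‖x‖ - R)]) (by linarith)
      have e3 : (5 * (R ^ 2 + ‖x‖ ^ 2)) ^ (σ / 2) = 5 ^ (σ / 2) * g x :=
        Real.mul_rpow (by norm_num) (by positivity)
      have e4 : (5 : ℝ) ^ (σ / 2) ≤ 5 ^ (1 : ℝ) :=
        Real.rpow_le_rpow_of_exponent_le (by norm_num) (by linarith)
      rw [Real.rpow_one] at e4
      have e5 : 0 ≤ g x := by simp only [hg]; positivity
      nlinarith
    have b1 : |u (x + t • e)| ≤ δ * (‖x‖ + 2 * R) ^ σ := by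
      refine (hu _).trans ?_
      have : ‖x + t • e‖ + R ≤ ‖x‖ + 2 * R := by linarith [norm_add_le x (t • e)]
      gcongr
    have b2 : |u (x - t • e)| ≤ δ * (‖x‖ + 2 * R) ^ σ := by
      refine (hu _).trans ?_
      have : ‖x - t • e‖ + R ≤ ‖x‖ + 2 * R := by linarith [norm_sub_le x (t • e)]
      gcongr
    have b3 := (abs_le.1 b1).2
    have b4 := (abs_le.1 b2).1
    have b5 := mul_le_mul_of_nonneg_left h5 hδ.le
    have : A / 2 * g x = 2 * (δ * (5 * g x)) := by rw [hA]; ring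
    linarith
  set r : ℝ := R * 2 ^ (1 / σ) with hr
  have hr0 : 0 ≤ r := by positivity
  have hrσ : r ^ σ = 2 * R ^ σ := by
    rw [hr, Real.mul_rpow hR0.le (by positivity), ← Real.rpow_mul (by norm_num)]
    rw [one_div_mul_cancel hσ.ne', Real.rpow_one]; ring
  have hquad : ∀ t, t ∈ Set.Icc 0 R → 0 ≤ K * (t * (2 * R - t)) := by
    intro t ht
    have : 0 ≤ t * (2 * R - t) := mul_nonneg ht.1 (by linarith [ht.2])
    positivity
  have hout : ∀ x t, t ∈ Set.Icc 0 R → r ≤ ‖x‖ → W (x, t) ≤ 0 := by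
    intro x t ht hx
    have h1 := hv x t ht
    have h2 := hquad t ht
    have h3 : 2 * R ^ σ ≤ g x := by
      rw [← hrσ]
      have e1 : r ^ σ = (r ^ 2) ^ (σ / 2) := by
        rw [← Real.rpow_natCast, ← Real.rpow_mul hr0]; congr 1; push_cast; ring
      rw [e1]
      exact Real.rpow_le_rpow (by positivity) (by nlinarith) (by linarith)
    have h4 := mul_le_mul_of_nonneg_left h3 hA0.le
    simp only [hW]
    linarith
  by_contra hcon
  push Not at hcon
  obtain ⟨x1, t1, ht1, hx1⟩ := hcon
  have hW1 : 0 < W (x1, t1) := by simp only [hW]; linarith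
  have hx1r : ‖x1‖ < r := by
    by_contra h
    have := hout x1 t1 ht1 (not_lt.1 h)
    linarith
  obtain ⟨⟨x0, t0⟩, hmem, hmax⟩ := ((isCompact_closedBall (0 : GS N) r).prod
    (isCompact_Icc (a := (0 : ℝ)) (b := R))).exists_isMaxOn
    ⟨(x1, t1), ⟨by simpa using hx1r.le, ht1⟩⟩ hWc.continuousOn
  have ht0 : t0 ∈ Set.Icc 0 R := hmem.2
  have hW0 : 0 < W (x0, t0) := lt_of_lt_of_le hW1
    (hmax (show (x1, t1) ∈ _ from ⟨by simpa using hx1r.le, ht1⟩))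
  have hglob : ∀ x t, t ∈ Set.Icc 0 R → W (x, t) ≤ W (x0, t0) := by
    intro x t ht
    by_cases hx : r ≤ ‖x‖
    · exact (hout x t ht hx).trans hW0.le
    · exact hmax (show (x, t) ∈ _ from ⟨by simpa using (not_le.1 hx).le, ht⟩)
  have ht0pos : 0 < t0 := by
    refine lt_of_le_of_ne ht0.1 fun h => ?_
    have h1 := hgR x0
    have h2 : 0 ≤ A * (g x0 - R ^ σ) := mul_nonneg hA0.le (by linarith)
    rw [← h] at hW0
    simp only [hW, zero_smul, add_zero, sub_zero, sub_self, zero_mul, mul_zero] at hW0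
    linarith
  have ht0R : t0 < R := by
    refine lt_of_le_of_ne ht0.2 fun h => ?_
    have h1 := hv x0 t0 ht0
    have h2 : A * R ^ σ ≤ K * (t0 * (2 * R - t0)) := by
      have e1 : K * (t0 * (2 * R - t0)) = A * (C0 * R) := by
        rw [h, hK]; field_simp; ring
      rw [e1]
      have e2 : R ^ σ ≤ R ^ (1 : ℝ) := Real.rpow_le_rpow_of_exponent_le hR hσ1
      rw [Real.rpow_one] at e2
      have e3 : R ≤ C0 * R := by nlinarith
      exact mul_le_mul_of_nonneg_left (e2.trans e3) hA0.le
    have h3 : 0 ≤ A * g x0 := mul_nonneg hA0.le ((Real.rpow_nonneg hR0.le σ).trans (hgR x0))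
    simp only [hW] at hW0
    linarith
  set p : GS N := x0 + t0 • e with hp
  set q : GS N := x0 - t0 • e with hq
  obtain ⟨hup, hip, hLp⟩ := hs' p (Set.mem_univ _)
  obtain ⟨huq, hiq, hLq⟩ := hs' q (Set.mem_univ _)
  have hfpq : f p = f q := by
    have : p = q + (2 * t0) • e := by rw [hp, hq, two_mul, add_smul]; abel
    rw [this, hf]
  have hterm : ∀ i, -(2 * A * C i * R⁻¹) ≤ gLap N i (s i) u p - gLap N i (s i) u q := by
    intro i
    refine hC i R A u p q hR hA0.le hup huq (hip i) (hiq i) fun y => ?_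
    set Y := grpIncl N i y with hY
    have hYn : ‖Y‖ = ‖y‖ := aux_incl_norm N i y
    have h1 := hglob (x0 + Y) t0 ht0
    have h2 := hglob (x0 - Y) t0 ht0
    have h3 := aux_g hσ hσ1 hR x0 Y
    rw [hYn] at h3
    simp only [hW] at h1 h2
    have e1 : x0 + Y + t0 • e = p + Y := by rw [hp]; abel
    have e2 : x0 + Y - t0 • e = q + Y := by rw [hq]; abel
    have e3 : x0 - Y + t0 • e = p - Y := by rw [hp]; abel
    have e4 : x0 - Y - t0 • e = q - Y := by rw [hq]; abel
    rw [e1, e2] at h1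
    rw [e3, e4] at h2
    have h4 : A * (g (x0 + Y) + g (x0 - Y) - 2 * g x0)
        ≤ A * (2 * min (‖y‖ ^ 2 * R ^ (σ - 2)) (‖y‖ ^ σ)) :=
      mul_le_mul_of_nonneg_left h3 hA0.le
    linarith
  have hlastt : 2 * K ≤ gLap N l (s l) u p - gLap N l (s l) u q := by
    rw [hlast, hlast]
    have h1 : dirD2 u p e - dirD2 u q (-e) ≤ -(2 * K) := by
      unfold dirD2
      have hlp := aux_line e hup
      have hlq := aux_line (-e) huq
      rw [← iteratedDeriv_sub (n := 2) hlp hlq]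
      refine aux_secdiff _ _ (hlp.sub hlq) ?_
      have hn : ∀ᶠ h in nhds (0 : ℝ), |h| < min t0 (R - t0) := by
        have : ContinuousAt (fun h : ℝ => |h|) 0 := continuous_abs.continuousAt
        exact this.eventually_lt continuousAt_const (by simpa using ⟨ht0pos, ht0R⟩)
      filter_upwards [hn] with h hh
      have hh1 := abs_lt.1 (lt_of_lt_of_le hh (min_le_left _ _))
      have hh2 := abs_lt.1 (lt_of_lt_of_le hh (min_le_right _ _))
      have m1 := hglob x0 (t0 + h) ⟨by linarith, by linarith⟩
      have m2 := hglob x0 (t0 - h) ⟨by linarith, by linarith⟩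
      simp only [hW] at m1 m2
      have e1 : x0 + (t0 + h) • e = p + h • e := by rw [hp, add_smul]; abel
      have e2 : x0 - (t0 + h) • e = q + h • (-e) := by rw [hq, add_smul, smul_neg]; abel
      have e3 : x0 + (t0 - h) • e = p + (-h) • e := by rw [hp, sub_smul, neg_smul]; abel
      have e4 : x0 - (t0 - h) • e = q + (-h) • (-e) := by
        rw [hq, sub_smul, neg_smul, smul_neg]; abel
      rw [e1, e2] at m1
      rw [e3, e4] at m2
      simp only [Pi.sub_apply, zero_smul, add_zero]
      nlinarith
    rw [aux_dir_neg] at h1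
    linarith
  have hzero : ∑ i, a i * (gLap N i (s i) u p - gLap N i (s i) u q) = 0 := by
    simp only [mul_sub, Finset.sum_sub_distrib]
    have := hLp.trans (hfpq.trans hLq.symm)
    unfold Lop at this
    linarith
  rw [← Finset.add_sum_erase _ _ (Finset.mem_univ l)] at hzero
  have hsum : -(2 * A * R⁻¹ * S) ≤
      ∑ i ∈ Finset.univ.erase l, a i * (gLap N i (s i) u p - gLap N i (s i) u q) := by
    rw [hS, Finset.mul_sum, ← Finset.sum_neg_distrib]
    refine Finset.sum_le_sum fun i _ => ?_
    have := mul_le_mul_of_nonneg_left (hterm i) (ha i)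
    linarith
  have h9 := mul_le_mul_of_nonneg_left hlastt hal.le
  have h10 : a l * (2 * K) = 2 * A * R⁻¹ * S + 2 * A * R⁻¹ * a l := by
    rw [hK, hC0d]; field_simp; ring
  have h11 : 0 < 2 * A * R⁻¹ * a l := by positivity
  linarith

lemma aux_main {m : ℕ} (N : Fin (m + 1) → ℕ)
    (s : Fin (m + 1) → ℝ) (hs : ∀ i, s i ∈ Set.Ioc (0 : ℝ) 1)
    (a : Fin (m + 1) → ℝ) (ha : ∀ i, 0 ≤ a i) (hal : 0 < a (Fin.last m))
    {σ : ℝ} (hσ : 0 < σ) (hσs : ∀ i, σ ≤ 2 * s i - 1)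
    (u f : GS N → ℝ) (hsol : IsSol N a s u f Set.univ) (e : GS N) (he : ‖e‖ ≤ 1)
    (hf : ∀ (x : GS N) (ρ : ℝ), f (x + ρ • e) = f x)
    (hlast : ∀ x, gLap N (Fin.last m) (s (Fin.last m)) u x = - dirD2 u x e)
    (M : ℝ → ℝ) (hM : ∀ (R : ℝ), ∀ x : GS N, ‖x‖ < R → |u x| ≤ M R)
    (hMo : Filter.Tendsto (fun R : ℝ => M R / R ^ σ) Filter.atTop (nhds 0))
    (x : GS N) (t : ℝ) (ht : 0 ≤ t) : u (x + t • e) ≤ u (x - t • e) := by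
  have hσ1 : σ ≤ 1 := by have := hσs (Fin.last m); have := (hs (Fin.last m)).2; linarith
  obtain ⟨C, hC1, hC⟩ := aux_barrier N s hs a ha hal hσ hσs u f hsol e he hf hlast
  have key : ∀ δ : ℝ, 0 < δ →
      u (x + t • e) - u (x - t • e) ≤ δ * (20 * (‖x‖ ^ σ + 2 * C * t)) := by
    intro δ hδ
    obtain ⟨R0, hR0⟩ := eventually_atTop.1 (hMo.eventually_lt_const hδ)
    set R := max (max 1 R0) t with hRd
    have hR1 : 1 ≤ R := (le_max_left _ _).trans (le_max_left _ _)
    have hRR0 : R0 ≤ R := (le_max_right _ _).trans (le_max_left _ _)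
    have hRt : t ≤ R := le_max_right _ _
    have hRp : 0 < R := by linarith
    have hu : ∀ y, |u y| ≤ δ * (‖y‖ + R) ^ σ := by
      intro y
      refine (hM (‖y‖ + R) y (by linarith)).trans ?_
      have := hR0 (‖y‖ + R) (by linarith [norm_nonneg y])
      rw [div_lt_iff₀ (by positivity)] at this
      exact this.le
    have h1 := hC δ R hδ hR1 hu x t ⟨ht, hRt⟩
    have h2 : (R ^ 2 + ‖x‖ ^ 2) ^ (σ / 2) ≤ R ^ σ + ‖x‖ ^ σ := by
      have e0 := Real.rpow_add_le_add_rpow (p := σ / 2) (a := R ^ 2) (b := ‖x‖ ^ 2)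
        (by positivity) (by positivity) (by linarith) (by linarith)
      have e1 : ∀ z : ℝ, 0 ≤ z → (z ^ 2) ^ (σ / 2) = z ^ σ := by
        intro z hz
        rw [← Real.rpow_natCast, ← Real.rpow_mul hz]; congr 1; push_cast; ring
      rwa [e1 _ hRp.le, e1 _ (norm_nonneg _)] at e0
    have h3 : 20 * δ * C / R * (t * (2 * R - t)) ≤ 20 * δ * C / R * (t * (2 * R)) := by
      gcongr; linarith
    have h4 : 20 * δ * C / R * (t * (2 * R)) = 20 * δ * (2 * C * t) := by field_simp
    have h5 : 20 * δ * ((R ^ 2 + ‖x‖ ^ 2) ^ (σ / 2) - R ^ σ) ≤ 20 * δ * ‖x‖ ^ σ := by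
      gcongr; linarith
    linarith
  have hlim : Tendsto (fun δ : ℝ => δ * (20 * (‖x‖ ^ σ + 2 * C * t)))
      (nhdsWithin 0 (Set.Ioi 0)) (nhds 0) := by
    have : Continuous (fun δ : ℝ => δ * (20 * (‖x‖ ^ σ + 2 * C * t))) := by fun_prop
    have h := this.tendsto 0
    simp only [zero_mul] at h
    exact h.mono_left nhdsWithin_le_nhds
  have := ge_of_tendsto hlim (eventually_nhdsWithin_of_forall fun δ hδ => key δ hδ)
  linarith

/-- Theorem 1.4: rigidity; if `f` does not depend on the `n`-th
coordinate and `u` grows slower than `R^σ`, then `u` does not depend on the `n`-th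
coordinate. -/
theorem stmt3 {m : ℕ} (N : Fin (m + 1) → ℕ) (hN : N (Fin.last m) = 1)
    (s : Fin (m + 1) → ℝ) (hs : ∀ i, s i ∈ Set.Ioc (0 : ℝ) 1)
    (hsl : s (Fin.last m) = 1)
    (a : Fin (m + 1) → ℝ) (ha : ∀ i, 0 ≤ a i) (hal : 0 < a (Fin.last m))
    (hσ : 0 < 2 * (⨅ i, s i) - 1)
    (u f : GS N → ℝ) (hsol : IsSol N a s u f Set.univ)
    (hf : ∀ (x : GS N) (ρ : ℝ), f (x + ρ • eN N) = f x)
    (M : ℝ → ℝ) (hM : ∀ (R : ℝ), ∀ x : GS N, ‖x‖ < R → |u x| ≤ M R)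
    (hMo : Filter.Tendsto (fun R : ℝ => M R / R ^ (2 * (⨅ i, s i) - 1))
      Filter.atTop (nhds 0)) :
    ∀ (x : GS N) (ρ : ℝ), u (x + ρ • eN N) = u x := by
  have hσs : ∀ i, 2 * (⨅ i, s i) - 1 ≤ 2 * s i - 1 := by
    intro i
    have := ciInf_le (Set.finite_range s).bddBelow i
    linarith
  have hone : ∀ j : Fin (N (Fin.last m)),
      grpIncl N (Fin.last m) (EuclideanSpace.single j 1) = eN N := by
    intro j
    unfold eN
    congr 1
    ext k
    have : k = j := by
      apply Fin.ext; have := k.2; have := j.2; omega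
    subst this
    simp
  have hlast : ∀ x, gLap N (Fin.last m) (s (Fin.last m)) u x = - dirD2 u x (eN N) := by
    intro x
    simp only [gLap, if_pos hsl, hone, Finset.sum_const, Finset.card_univ, Fintype.card_fin, hN,
      one_smul]
  have hnorm : ‖eN N‖ ≤ 1 := by
    have hpos : 0 < N (Fin.last m) := by omega
    rw [← hone ⟨0, hpos⟩, aux_incl_norm]
    simp
  have h1 := aux_main N s hs a ha hal hσ hσs u f hsol (eN N) hnorm hf hlast M hM hMo
  have h2 := aux_main N s hs a ha hal hσ hσs u f hsol (-eN N) (by rwa [norm_neg])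
    (fun x ρ => by rw [smul_neg, ← neg_smul]; exact hf x _)
    (fun x => by rw [hlast, aux_dir_neg]) M hM hMo
  have h3 : ∀ (x : GS N) (t : ℝ), 0 ≤ t → u (x + t • eN N) = u (x - t • eN N) := by
    intro x t ht
    refine le_antisymm (h1 x t ht) ?_
    have := h2 x t ht
    rwa [smul_neg, sub_neg_eq_add, ← sub_eq_add_neg] at this
  have h4 : ∀ (x : GS N) (t : ℝ), 0 ≤ t → u (x + t • eN N) = u x := by
    intro x t ht
    have := h3 (x + (t / 2) • eN N) (t / 2) (by linarith)
    rwa [add_sub_cancel_right, add_assoc, ← add_smul, add_halves] at this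
  intro x ρ
  rcases le_total 0 ρ with h | h
  · exact h4 x ρ h
  · have := h4 (x + ρ • eN N) (-ρ) (by linarith)
    rw [neg_smul, add_neg_cancel_right] at this
    exact this.symm

end
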